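/- arXiv:2405.01049 — 2 statements merged into one kernel-verified Lean document; each statement's English description precedes it below -/
import Mathlib

section
/- For a partition λ = (λ_1 ≥ ... ≥ λ_k > 0) and n ≥ k, the key polynomial indexed by the weakly increasing composition 0^{n−k} * rev(λ) (n−k zeros followed by the reverse of λ) equals the Schur polynomial: K_{(0,...,0,λ_k,...,λ_1)}(x_1,...,x_n) = s_λ(x_1,...,x_n). -/
open MvPolynomial in
/-- A family of key polynomials for `n` variables: `K α = x^α` when `α` is weakly
decreasing, and `K (s_i α) = ξ_i (K α)` when `α_i > α_{i+1}`, where `ξ_i` is the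
isobaric divided difference operator (characterized by multiplication by
`x_i - x_{i+1}`). These properties determine `K` uniquely. -/
def IsKeyFamily (n : ℕ) (K : (Fin n → ℕ) → MvPolynomial (Fin n) ℚ) : Prop :=
  (∀ α : Fin n → ℕ, Antitone α → K α = ∏ i, X i ^ α i) ∧
  (∀ (α : Fin n → ℕ) (a b : Fin n), (b : ℕ) = (a : ℕ) + 1 → α b < α a →
    (X a - X b) * K (α ∘ Equiv.swap a b)
      = X a * K α - X b * rename (Equiv.swap a b) (K α))

open MvPolynomial


namespace KeyAux

variable {n : ℕ}

/-- the action of the transposition `(a b)` on polynomials -/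
noncomputable def sw (a b : Fin n) (f : MvPolynomial (Fin n) ℚ) : MvPolynomial (Fin n) ℚ :=
  rename (Equiv.swap a b) f

lemma sw_mul (a b : Fin n) (f g) : sw a b (f * g) = sw a b f * sw a b g := by simp [sw]
lemma sw_sub (a b : Fin n) (f g) : sw a b (f - g) = sw a b f - sw a b g := by simp [sw]
lemma sw_add (a b : Fin n) (f g) : sw a b (f + g) = sw a b f + sw a b g := by simp [sw]
lemma sw_sw (a b : Fin n) (f) : sw a b (sw a b f) = f := by
  simp only [sw, rename_rename]
  have : (⇑(Equiv.swap a b) ∘ ⇑(Equiv.swap a b)) = id := by ext; simp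
  rw [this]; simp
lemma sw_X (a b c : Fin n) : sw a b (X c) = X (Equiv.swap a b c) := by simp [sw]
lemma sw_Xl (a b : Fin n) : sw a b (X a) = X b := by simp [sw]
lemma sw_Xr (a b : Fin n) : sw a b (X b) = X a := by simp [sw]
lemma sw_Xo (a b c : Fin n) (h1 : c ≠ a) (h2 : c ≠ b) : sw a b (X c) = X c := by
  simp [sw, Equiv.swap_apply_of_ne_of_ne h1 h2]

lemma sw_comm (a b c d : Fin n) (h1 : c ≠ a) (h2 : c ≠ b) (h3 : d ≠ a) (h4 : d ≠ b) (f) :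
    sw a b (sw c d f) = sw c d (sw a b f) := by
  simp only [sw, rename_rename]
  congr 2
  ext x
  simp only [Function.comp, Equiv.swap_apply_def]
  grind

lemma sw_braid (a b c : Fin n) (h1 : a ≠ b) (h2 : b ≠ c) (h3 : a ≠ c) (f) :
    sw a b (sw b c (sw a b f)) = sw b c (sw a b (sw b c f)) := by
  simp only [sw, rename_rename]
  congr 2
  ext x
  simp only [Function.comp, Equiv.swap_apply_def]
  grind

lemma X_sub_ne {a b : Fin n} (h : a ≠ b) : (X a - X b : MvPolynomial (Fin n) ℚ) ≠ 0 := by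
  rw [sub_ne_zero]
  exact fun e => h (X_injective e)

lemma sym_of_eq {a b : Fin n} (h : a ≠ b) {f g : MvPolynomial (Fin n) ℚ}
    (e : (X a - X b) * g = X a * f - X b * sw a b f) : sw a b g = g := by
  have e2 := congrArg (sw a b) e
  simp only [sw_mul, sw_sub, sw_sw, sw_Xl, sw_Xr] at e2
  apply mul_left_cancel₀ (X_sub_ne h)
  linear_combination -e2 - e

lemma three1 {a b c : Fin n} (h1 : a ≠ b) (h2 : b ≠ c) (h3 : a ≠ c)
    {f g h : MvPolynomial (Fin n) ℚ} (hf : sw b c f = f)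
    (eg : (X a - X b) * g = X a * f - X b * sw a b f)
    (eh : (X b - X c) * h = X b * g - X c * sw b c g) : sw a b h = h := by
  have e2 := congrArg (sw b c) eg
  simp only [sw_mul, sw_sub, sw_Xl, sw_Xr, sw_Xo _ _ _ h1 h3, hf] at e2
  have E : (X a - X b) * (X a - X c) * (X b - X c) * h =
      X a ^ 2 * (X b - X c) * f - X b ^ 2 * (X a - X c) * sw a b f
        + X c ^ 2 * (X a - X b) * sw b c (sw a b f) := by
    linear_combination (X a - X b) * (X a - X c) * eh + X b * (X a - X c) * eg
      - X c * (X a - X b) * e2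
  have E2 := congrArg (sw a b) E
  simp only [pow_two, sw_mul, sw_sub, sw_add, sw_Xl, sw_Xr, sw_sw,
    sw_Xo _ _ _ h3.symm h2.symm, sw_braid a b c h1 h2 h3, hf] at E2
  apply mul_left_cancel₀ (mul_ne_zero (mul_ne_zero (X_sub_ne h1) (X_sub_ne h3)) (X_sub_ne h2))
  linear_combination -E2 - E

lemma three2 {a b c : Fin n} (h1 : a ≠ b) (h2 : b ≠ c) (h3 : a ≠ c)
    {f g h : MvPolynomial (Fin n) ℚ} (hf : sw a b f = f)
    (eg : (X b - X c) * g = X b * f - X c * sw b c f)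
    (eh : (X a - X b) * h = X a * g - X b * sw a b g) : sw b c h = h := by
  have e2 := congrArg (sw a b) eg
  simp only [sw_mul, sw_sub, sw_Xl, sw_Xr, sw_Xo _ _ _ h3.symm h2.symm, hf] at e2
  have E : (X a - X b) * (X a - X c) * (X b - X c) * h =
      X a * X b * (X a - X b) * f - X a * X c * (X a - X c) * sw b c f
        + X b * X c * (X b - X c) * sw a b (sw b c f) := by
    linear_combination (X b - X c) * (X a - X c) * eh + X a * (X a - X c) * eg
      - X b * (X b - X c) * e2
  have E2 := congrArg (sw b c) E
  simp only [sw_mul, sw_sub, sw_add, sw_Xl, sw_Xr, sw_sw,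
    sw_Xo _ _ _ h1 h3, ← sw_braid a b c h1 h2 h3, hf] at E2
  apply mul_left_cancel₀ (mul_ne_zero (mul_ne_zero (X_sub_ne h1) (X_sub_ne h3)) (X_sub_ne h2))
  linear_combination -E2 - E

/-- induction measure -/
def wt (α : Fin n → ℕ) : ℕ := ∑ i : Fin n, (i : ℕ) * α i

lemma wt_lt (α : Fin n → ℕ) (a b : Fin n) (hab : (b : ℕ) = a + 1) (h : α a < α b) :
    wt (α ∘ Equiv.swap a b) < wt α := by
  have hne : a ≠ b := by intro e; rw [e] at hab; omega
  have key : ∀ β : Fin n → ℕ, wt β = a * β a + (b * β b +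
      ∑ i ∈ (Finset.univ.erase a).erase b, (i : ℕ) * β i) := by
    intro β
    rw [Finset.add_sum_erase _ (fun i : Fin n => (i : ℕ) * β i) (by simp [hne.symm]),
      Finset.add_sum_erase _ (fun i : Fin n => (i : ℕ) * β i) (by simp)]
    rfl
  rw [key, key α]
  have : ∑ i ∈ (Finset.univ.erase a).erase b, (i : ℕ) * (α ∘ Equiv.swap a b) i
      = ∑ i ∈ (Finset.univ.erase a).erase b, (i : ℕ) * α i := by
    apply Finset.sum_congr rfl
    intro i hi
    simp only [Finset.mem_erase] at hi
    simp [Equiv.swap_apply_of_ne_of_ne hi.2.1 hi.1]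
  rw [this]
  simp only [Function.comp, Equiv.swap_apply_left, Equiv.swap_apply_right, hab]
  nlinarith

lemma exists_ascent (α : Fin n → ℕ) (h : ¬ Antitone α) :
    ∃ a b : Fin n, (b : ℕ) = a + 1 ∧ α a < α b := by
  by_contra! hc
  apply h
  cases n with
  | zero => intro a; exact a.elim0
  | succ m => exact Fin.antitone_iff_succ_le.2 fun i => hc i.castSucc i.succ (by simp)

lemma comp_swap_swap (α : Fin n → ℕ) (a b : Fin n) :
    (α ∘ Equiv.swap a b) ∘ Equiv.swap a b = α := by ext; simp

variable {K : (Fin n → ℕ) → MvPolynomial (Fin n) ℚ}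

lemma rec_eq (hK : IsKeyFamily n K) (α : Fin n → ℕ) (a b : Fin n) (hab : (b : ℕ) = a + 1)
    (h : α a < α b) :
    (X a - X b) * K α = X a * K (α ∘ Equiv.swap a b) - X b * sw a b (K (α ∘ Equiv.swap a b)) := by
  have := hK.2 (α ∘ Equiv.swap a b) a b hab (by simpa using h)
  rwa [comp_swap_swap] at this

lemma key_sym (hK : IsKeyFamily n K) : ∀ (N : ℕ) (α : Fin n → ℕ), wt α = N → ∀ a b : Fin n,
    (b : ℕ) = a + 1 → α a = α b → sw a b (K α) = K α := by
  intro N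
  induction N using Nat.strong_induction_on with
  | _ N ih =>
  intro α hα a b hab heq
  have nab : a ≠ b := by intro e; rw [e] at hab; omega
  by_cases hanti : Antitone α
  · rw [hK.1 α hanti]
    simp only [sw, map_prod, map_pow, rename_X]
    rw [← Equiv.prod_comp (Equiv.swap a b)]
    apply Finset.prod_congr rfl
    intro i _
    simp only [Equiv.swap_apply_self]
    congr 1
    rw [Equiv.swap_apply_def]
    grind
  · obtain ⟨i, j, hij, hlt⟩ := exists_ascent α hanti
    have nij : i ≠ j := by intro e; rw [e] at hij; omega
    have w1 := wt_lt α i j hij hlt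
    have e1 := rec_eq hK α i j hij hlt
    by_cases c1 : i = b
    · subst c1
      have naj : a ≠ j := by intro e; rw [e] at hab; omega
      set β := α ∘ Equiv.swap i j with hβ
      have ba : β a = α a := by simp [hβ, Equiv.swap_apply_of_ne_of_ne nab naj]
      have bi : β i = α j := by simp [hβ]
      have bj : β j = α i := by simp [hβ]
      have l2 : β a < β i := by omega
      have w2 := wt_lt β a i hab l2
      have e2 := rec_eq hK β a i hab l2
      refine three1 nab nij naj ?_ e2 e1
      refine ih _ (by omega) _ rfl i j hij ?_
      simp [Equiv.swap_apply_of_ne_of_ne naj.symm nij.symm]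
      omega
    by_cases c2 : j = a
    · subst c2
      have nib : i ≠ b := by intro e; rw [e] at hij; omega
      set β := α ∘ Equiv.swap i j with hβ
      have bb : β b = α b := by simp [hβ, Equiv.swap_apply_of_ne_of_ne nib.symm nab.symm]
      have bi : β i = α j := by simp [hβ]
      have bj : β j = α i := by simp [hβ]
      have l2 : β j < β b := by omega
      have w2 := wt_lt β j b hab l2
      have e2 := rec_eq hK β j b hab l2
      refine three2 nij nab nib ?_ e2 e1
      refine ih _ (by omega) _ rfl i j hij ?_
      simp [Equiv.swap_apply_of_ne_of_ne nij nib]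
      omega
    have nia : i ≠ a := by
      rintro rfl
      have : b = j := Fin.ext (by omega)
      subst this; omega
    have njb : j ≠ b := by
      rintro rfl
      exact nia (Fin.ext (by omega))
    have hg := ih _ (by omega) (α ∘ Equiv.swap i j) rfl a b hab (by
      simp [Equiv.swap_apply_of_ne_of_ne nia.symm (Ne.symm c2),
        Equiv.swap_apply_of_ne_of_ne (Ne.symm c1) njb.symm, heq])
    have e2 := congrArg (sw a b) e1
    simp only [sw_mul, sw_sub, sw_Xo a b i nia c1, sw_Xo a b j c2 njb,
      sw_comm a b i j nia c1 c2 njb, hg] at e2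
    apply mul_left_cancel₀ (X_sub_ne nij)
    rw [e1, e2]

lemma key_sym_le (hK : IsKeyFamily n K) (α : Fin n → ℕ) (a b : Fin n)
    (hab : (b : ℕ) = a + 1) (h : α a ≤ α b) : sw a b (K α) = K α := by
  have nab : a ≠ b := by intro e; rw [e] at hab; omega
  rcases h.eq_or_lt with h | h
  · exact key_sym hK _ α rfl a b hab h
  · exact sym_of_eq nab (rec_eq hK α a b hab h)

lemma key_sym_all (hK : IsKeyFamily n K) (α : Fin n → ℕ) (h : Monotone α)
    (σ : Equiv.Perm (Fin n)) : rename σ (K α) = K α := by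
  cases n with
  | zero =>
    have : σ = 1 := Subsingleton.elim _ _
    subst this
    simp
  | succ m =>
    have hσ : σ ∈ Submonoid.closure (Set.range fun i : Fin m => Equiv.swap i.castSucc i.succ) := by
      rw [Equiv.Perm.mclosure_swap_castSucc_succ]; trivial
    induction hσ using Submonoid.closure_induction with
    | mem x hx =>
      obtain ⟨i, rfl⟩ := hx
      exact key_sym_le hK α _ _ (by simp) (h (Fin.castSucc_lt_succ).le)
    | one => simp
    | mul x y _ _ hx hy =>
      rw [Equiv.Perm.coe_mul, ← rename_rename, hy, hx]

/-- antisymmetrizer -/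
noncomputable def A (f : MvPolynomial (Fin n) ℚ) : MvPolynomial (Fin n) ℚ :=
  ∑ σ : Equiv.Perm (Fin n), ((Equiv.Perm.sign σ : ℤ) : MvPolynomial (Fin n) ℚ) * rename σ f

lemma A_sub (f g : MvPolynomial (Fin n) ℚ) : A (f - g) = A f - A g := by
  simp [A, mul_sub, Finset.sum_sub_distrib]

lemma A_sw {a b : Fin n} (h : a ≠ b) (f : MvPolynomial (Fin n) ℚ) : A (sw a b f) = - A f := by
  unfold A sw
  rw [← Finset.sum_neg_distrib, ← Equiv.sum_comp (Equiv.mulRight (Equiv.swap a b))]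
  apply Finset.sum_congr rfl
  intro σ _
  rw [rename_rename]
  have : (⇑((Equiv.mulRight (Equiv.swap a b)) σ) ∘ ⇑(Equiv.swap a b)) = σ := by ext; simp
  rw [this]
  simp [Equiv.Perm.sign_swap h]

lemma A_mul_sym (f g : MvPolynomial (Fin n) ℚ) (hg : ∀ σ : Equiv.Perm (Fin n), rename σ g = g) :
    A (f * g) = A f * g := by
  simp [A, hg, Finset.sum_mul, mul_assoc]

/-- monomial -/
noncomputable def mo (α : Fin n → ℕ) : MvPolynomial (Fin n) ℚ := ∏ i, X i ^ α i

/-- staircase -/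
def st (n : ℕ) : Fin n → ℕ := fun j => n - 1 - (j : ℕ)

lemma st_rel (a b : Fin n) (hab : (b : ℕ) = a + 1) :
    X b * mo (st n) = X a * sw a b (mo (st n)) := by
  have hne : a ≠ b := by intro e; rw [e] at hab; omega
  have key : ∀ β : Fin n → MvPolynomial (Fin n) ℚ, ∏ i, β i = β a * (β b *
      ∏ i ∈ (Finset.univ.erase a).erase b, β i) := by
    intro β
    rw [Finset.mul_prod_erase _ β (by simp [hne.symm]),
      Finset.mul_prod_erase _ β (by simp)]
  simp only [mo, sw, map_prod, map_pow, rename_X]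
  rw [key, key (fun i => X (Equiv.swap a b i) ^ st n i)]
  have : ∏ i ∈ (Finset.univ.erase a).erase b, (X (Equiv.swap a b i) : MvPolynomial (Fin n) ℚ) ^ st n i
      = ∏ i ∈ (Finset.univ.erase a).erase b, X i ^ st n i := by
    apply Finset.prod_congr rfl
    intro i hi
    simp only [Finset.mem_erase] at hi
    simp [Equiv.swap_apply_of_ne_of_ne hi.2.1 hi.1]
  rw [this]
  have hs : st n a = st n b + 1 := by have := b.2; simp only [st]; omega
  simp only [Equiv.swap_apply_left, Equiv.swap_apply_right, hs]
  ring

lemma A_step {a b : Fin n} (hab : (b : ℕ) = a + 1) {f g : MvPolynomial (Fin n) ℚ}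
    (e : (X a - X b) * g = X a * f - X b * sw a b f) :
    A (mo (st n) * g) = A (mo (st n) * f) := by
  have hne : a ≠ b := by intro e; rw [e] at hab; omega
  have hg := sym_of_eq hne e
  have hR := st_rel a b hab
  have h : mo (st n) * g - sw a b (mo (st n) * g) = mo (st n) * f - sw a b (mo (st n) * f) := by
    apply mul_left_cancel₀ (X_ne_zero a : (X a : MvPolynomial (Fin n) ℚ) ≠ 0)
    simp only [sw_mul, hg]
    linear_combination mo (st n) * e + (g - sw a b f) * hR
  have h2 := congrArg A h
  simp only [A_sub, A_sw hne] at h2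
  have h3 : (2 : MvPolynomial (Fin n) ℚ) ≠ 0 := two_ne_zero
  apply mul_left_cancel₀ h3
  linear_combination h2

lemma A_key (hK : IsKeyFamily n K) (lam : Fin n → ℕ) (hl : Antitone lam) :
    ∀ (N : ℕ) (α : Fin n → ℕ), wt α = N → ∀ σ : Equiv.Perm (Fin n), α = lam ∘ σ →
      A (mo (st n) * K α) = A (mo (st n) * mo lam) := by
  intro N
  induction N using Nat.strong_induction_on with
  | _ N ih =>
  intro α hα σ hσ
  by_cases hanti : Antitone α
  · have : α = lam := by
      have := Tuple.unique_monotone (f := OrderDual.toDual ∘ lam) (σ := σ) (τ := 1)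
        (by rw [Function.comp_assoc, ← hσ]; exact fun x y h => hanti h)
        (fun x y h => hl h)
      rw [hσ]
      exact this
    rw [hK.1 α hanti, this]; rfl
  · obtain ⟨i, j, hij, hlt⟩ := exists_ascent α hanti
    have w1 := wt_lt α i j hij hlt
    rw [A_step hij (rec_eq hK α i j hij hlt)]
    exact ih _ (by omega) _ rfl (σ * Equiv.swap i j) (by rw [hσ]; rfl)

lemma A_mo (β : Fin n → ℕ) :
    A (mo β) = Matrix.det (Matrix.of fun i j : Fin n => (X i : MvPolynomial (Fin n) ℚ) ^ β j) := by
  rw [Matrix.det_apply']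
  simp [A, mo]

lemma det_st : Matrix.det (Matrix.of fun i j : Fin n => (X i : MvPolynomial (Fin n) ℚ) ^ st n j) =
    ∏ p ∈ Finset.univ.filter (fun p : Fin n × Fin n => p.1 < p.2), (X p.1 - X p.2) := by
  rw [← Matrix.det_submatrix_equiv_self Fin.revPerm]
  have : (Matrix.of fun i j : Fin n => (X i : MvPolynomial (Fin n) ℚ) ^ st n j).submatrix
      Fin.revPerm Fin.revPerm = Matrix.vandermonde (fun i => X i.rev) := by
    ext1 i j
    simp only [Matrix.submatrix_apply, Matrix.of_apply, Matrix.vandermonde_apply,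
      Fin.revPerm_apply, st, Fin.val_rev]
    congr 1
    omega
  rw [this, Matrix.det_vandermonde, Finset.prod_sigma']
  refine Finset.prod_bij' (fun p _ => (p.2.rev, p.1.rev)) (fun p _ => ⟨p.2.rev, p.1.rev⟩)
    ?_ ?_ ?_ ?_ ?_ <;> simp

end KeyAux

/-- For a partition `λ = (λ_1 ≥ ... ≥ λ_k > 0)` and `n ≥ k`, the key polynomial
indexed by `0^{n-k} * rev(λ)` equals the Schur polynomial
`s_λ = det(x_i^{λ_j + n - j}) / det(x_i^{n-j})`. Here `lam'` is `λ` padded with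
zeros to length `n`, and `S` is the Schur polynomial, characterized by the
bialternant formula (multiplied through by the Vandermonde determinant). -/
theorem key_of_reversed_partition_is_schur (n k : ℕ) (hkn : k ≤ n)
    (lam : Fin k → ℕ) (hpos : ∀ i, 0 < lam i) (hanti : Antitone lam)
    (K : (Fin n → ℕ) → MvPolynomial (Fin n) ℚ) (hK : IsKeyFamily n K)
    (lam' : Fin n → ℕ)
    (hlam' : ∀ j : Fin n, lam' j = if h : (j : ℕ) < k then lam ⟨j, h⟩ else 0)
    (S : MvPolynomial (Fin n) ℚ)
    (hS : (∏ p ∈ Finset.univ.filter (fun p : Fin n × Fin n => p.1 < p.2), (X p.1 - X p.2)) * S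
      = Matrix.det (Matrix.of fun i j : Fin n => X i ^ (lam' j + (n - 1 - (j : ℕ))))) :
    K (fun j => lam' j.rev) = S := by
  have hl : Antitone lam' := by
    intro i j hij
    rw [hlam', hlam']
    have hij' : (i : ℕ) ≤ j := hij
    split_ifs with h1 h2
    · exact hanti hij'
    · omega
    · simp
    · simp
  have hm : Monotone (fun j : Fin n => lam' j.rev) := fun i j h => hl (Fin.rev_le_rev.2 h)
  have h1 := KeyAux.A_key hK lam' hl _ (fun j => lam' j.rev) rfl Fin.revPerm rfl
  rw [KeyAux.A_mul_sym _ _ (KeyAux.key_sym_all hK _ hm), KeyAux.A_mo, KeyAux.det_st] at h1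
  have h2 : KeyAux.mo (KeyAux.st n) * KeyAux.mo lam'
      = KeyAux.mo (fun j => lam' j + (n - 1 - (j : ℕ))) := by
    simp only [KeyAux.mo, KeyAux.st, ← Finset.prod_mul_distrib, ← pow_add, add_comm]
  rw [h2, KeyAux.A_mo, ← hS] at h1
  refine mul_left_cancel₀ ?_ h1
  rw [Finset.prod_ne_zero_iff]
  intro p hp
  exact KeyAux.X_sub_ne (Finset.mem_filter.1 hp).2.ne
end

section
/- Every key polynomial K_α has nonnegative integer coefficients in its monomial expansion. -/
namespace KeyPos
open MvPolynomial Finset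

abbrev R := MvPolynomial ℕ ℚ

/-- the simple transposition acting on variables -/
noncomputable def s (i : ℕ) : R →ₐ[ℚ] R := rename (Equiv.swap i (i+1))

/-- `g = ξ_i f` -/
def IsXi (i : ℕ) (f g : R) : Prop :=
  (X i - X (i+1)) * g = X i * f - X (i+1) * s i f

lemma s_X (i j : ℕ) : s i (X j) = X (Equiv.swap i (i+1) j) := by
  simp [s]

lemma s_X_left (i : ℕ) : s i (X i) = X (i+1) := by simp [s_X]
lemma s_X_right (i : ℕ) : s i (X (i+1)) = X i := by simp [s_X]
lemma s_X_other (i j : ℕ) (h1 : j ≠ i) (h2 : j ≠ i+1) : s i (X j) = X j := by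
  rw [s_X, Equiv.swap_apply_of_ne_of_ne h1 h2]

lemma s_s (i : ℕ) (f : R) : s i (s i f) = f := by
  simp only [s, rename_rename]
  have : (⇑(Equiv.swap i (i+1)) ∘ ⇑(Equiv.swap i (i+1))) = id := by
    funext x; simp
  rw [this]; simp

lemma s_comm (i j : ℕ) (h : i + 2 ≤ j ∨ j + 2 ≤ i) (f : R) : s i (s j f) = s j (s i f) := by
  simp only [s, rename_rename]
  congr 2
  funext x
  simp only [Function.comp, Equiv.swap_apply_def]
  grind

lemma s_braid (i : ℕ) (f : R) :
    s i (s (i+1) (s i f)) = s (i+1) (s i (s (i+1) f)) := by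
  simp only [s, rename_rename]
  congr 2
  funext x
  simp only [Function.comp, Equiv.swap_apply_def]
  grind

lemma X_ne {i j : ℕ} (h : i ≠ j) : (X i - X j : R) ≠ 0 := by
  intro h0
  exact h (X_injective (sub_eq_zero.1 h0))

lemma IsXi.unique {i : ℕ} {f g g' : R} (h : IsXi i f g) (h' : IsXi i f g') : g = g' :=
  mul_left_cancel₀ (X_ne (Nat.ne_of_lt (Nat.lt_succ_self i))) (h.trans h'.symm)

lemma IsXi.add {i : ℕ} {f g f' g' : R} (h : IsXi i f g) (h' : IsXi i f' g') :
    IsXi i (f + f') (g + g') := by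
  unfold IsXi at *
  rw [map_add]; linear_combination h + h'

lemma IsXi.zero (i : ℕ) : IsXi i 0 0 := by simp [IsXi]

lemma IsXi.sum {i : ℕ} (S : Finset ℕ) {f g : ℕ → R} (h : ∀ c ∈ S, IsXi i (f c) (g c)) :
    IsXi i (∑ c ∈ S, f c) (∑ c ∈ S, g c) := by
  classical
  induction S using Finset.induction_on with
  | empty => simpa using IsXi.zero i
  | insert a S ha ih =>
    rw [sum_insert ha, sum_insert ha]
    exact (h a (by simp)).add (ih fun c hc => h c (by simp [hc]))

lemma IsXi.of_symm {i : ℕ} {f : R} (h : s i f = f) : IsXi i f f := by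
  unfold IsXi; rw [h]; ring

lemma IsXi.mul {i : ℕ} {f g h : R} (hs : s i h = h) (hf : IsXi i f g) :
    IsXi i (h * f) (h * g) := by
  unfold IsXi at *
  rw [map_mul, hs]; linear_combination h * hf

lemma IsXi.symm_right {i : ℕ} {f g : R} (h : IsXi i f g) : s i g = g := by
  have h2 := congrArg (s i) h
  simp only [map_mul, map_sub, s_X_left, s_X_right, s_s] at h2
  unfold IsXi at h
  apply mul_left_cancel₀ (X_ne (Nat.ne_of_lt (Nat.lt_succ_self i)))
  linear_combination -h2 - h

lemma IsXi.pow (i m : ℕ) :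
    IsXi i (X i ^ m) (∑ j ∈ range (m+1), X i ^ (m - j) * X (i+1) ^ j) := by
  unfold IsXi
  rw [map_pow, s_X_left]
  have h := (Commute.all (X (i+1) : R) (X i)).mul_geom_sum₂ (m+1)
  have e : ∑ j ∈ range (m+1), (X (i+1) : R) ^ j * X i ^ (m + 1 - 1 - j)
     = ∑ j ∈ range (m+1), X i ^ (m - j) * X (i+1) ^ j := by
    apply sum_congr rfl
    intro j _
    rw [Nat.add_sub_cancel, mul_comm]
  rw [e] at h
  rw [pow_succ, pow_succ] at h
  linear_combination -h

lemma IsXi.mono (i p b c : ℕ) (hbc : b ≤ c) :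
    IsXi i (X (i+1) ^ p * X i ^ (p + c - b))
      (∑ d ∈ Icc b c, X (i+1) ^ (p + d - b) * X i ^ (p + c - d)) := by
  obtain ⟨m, rfl⟩ := Nat.exists_eq_add_of_le hbc
  have h := (IsXi.pow i m).mul (h := X i ^ p * X (i+1) ^ p)
    (by rw [map_mul, map_pow, map_pow, s_X_left, s_X_right, mul_comm])
  convert h using 1
  · rw [show p + (b + m) - b = p + m by omega]; ring
  · rw [mul_sum, ← Finset.Ico_add_one_right_eq_Icc, sum_Ico_eq_sum_range]
    rw [show b + m + 1 - b = m + 1 by omega]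
    apply sum_congr rfl
    intro j hj
    rw [mem_range] at hj
    rw [show p + (b + j) - b = p + j by omega, show p + (b+m) - (b+j) = p + (m - j) by omega]
    ring

lemma core (r p b l a : ℕ) (h : ℕ → R) (hs : ∀ c, s r (h c) = h c) :
    IsXi r (X (r+1) ^ p * ∑ c ∈ Icc (max b l) a, X r ^ (p + c - b) * h c)
      (∑ d ∈ Icc b a, X (r+1) ^ (p + d - b) *
        ∑ c ∈ Icc (max d l) a, X r ^ (p + c - d) * h c) := by
  have key := IsXi.sum (i := r) (Icc (max b l) a)
    (f := fun c => h c * (X (r+1) ^ p * X r ^ (p + c - b)))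
    (g := fun c => h c * ∑ d ∈ Icc b c, X (r+1) ^ (p + d - b) * X r ^ (p + c - d))
    (fun c hc => (IsXi.mono r p b c (by rw [mem_Icc] at hc; omega)).mul (hs c))
  convert key using 1
  · rw [mul_sum]; apply sum_congr rfl; intros; ring
  · simp only [mul_sum]
    rw [sum_comm' (t' := Icc (max b l) a) (s' := fun c => Icc b c)]
    · apply sum_congr rfl; intros; apply sum_congr rfl; intros; ring
    · intro x y; simp only [mem_Icc]; omega

/-- distant symmetries survive -/
lemma IsXi.far {i j : ℕ} (h : i + 2 ≤ j ∨ j + 2 ≤ i) {f g : R} (hf : IsXi j f g)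
    (hs : s i f = f) : s i g = g := by
  have h2 := congrArg (s i) hf
  simp only [map_mul, map_sub] at h2
  rw [s_comm i j h, hs, s_X_other i j (by omega) (by omega),
    s_X_other i (j+1) (by omega) (by omega)] at h2
  exact IsXi.unique h2 hf

lemma braid1 {i : ℕ} {D E G : R} (hD : s (i+1) D = D) (h1 : IsXi i D E)
    (h2 : IsXi (i+1) E G) : s i G = G := by
  have x1 : s (i+1) (X i) = X i := s_X_other _ _ (by omega) (by omega)
  have x2 : s i (X (i+1+1)) = X (i+1+1) := s_X_other _ _ (by omega) (by omega)
  have h3 := congrArg (s (i+1)) h1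
  have hb := s_braid i D
  rw [hD] at hb
  simp only [map_mul, map_sub, s_X_left, x1, hD] at h3
  unfold IsXi at h1 h2
  have N : (X i - X (i+1)) * (X i - X (i+1+1)) * (X (i+1) - X (i+1+1)) * G
      = X (i+1) * (X i - X (i+1+1)) * (X i * D - X (i+1) * s i D)
       - X (i+1+1) * (X i - X (i+1)) * (X i * D - X (i+1+1) * s (i+1) (s i D)) := by
    linear_combination (X i - X (i+1)) * (X i - X (i+1+1)) * h2
      + X (i+1) * (X i - X (i+1+1)) * h1 - X (i+1+1) * (X i - X (i+1)) * h3
  have N2 := congrArg (s i) N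
  simp only [map_mul, map_sub, s_X_left, s_X_right, x2, s_s, hb] at N2
  apply mul_left_cancel₀ (mul_ne_zero (mul_ne_zero (X_ne (i := i) (j := i+1) (by omega))
    (X_ne (i := i) (j := i+1+1) (by omega))) (X_ne (i := i+1) (j := i+1+1) (by omega)))
  linear_combination -N2 - N

lemma braid2 {i : ℕ} {D E G : R} (hD : s i D = D) (h1 : IsXi (i+1) D E)
    (h2 : IsXi i E G) : s (i+1) G = G := by
  have x1 : s (i+1) (X i) = X i := s_X_other _ _ (by omega) (by omega)
  have x2 : s i (X (i+1+1)) = X (i+1+1) := s_X_other _ _ (by omega) (by omega)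
  have h3 := congrArg (s i) h1
  have hb := s_braid i D
  rw [hD] at hb
  simp only [map_mul, map_sub, s_X_right, x2, hD] at h3
  unfold IsXi at h1 h2
  have N : (X i - X (i+1)) * (X i - X (i+1+1)) * (X (i+1) - X (i+1+1)) * G
      = X i * (X i - X (i+1+1)) * (X (i+1) * D - X (i+1+1) * s (i+1) D)
       - X (i+1) * (X (i+1) - X (i+1+1)) * (X i * D - X (i+1+1) * s i (s (i+1) D)) := by
    linear_combination (X i - X (i+1+1)) * (X (i+1) - X (i+1+1)) * h2
      + X i * (X i - X (i+1+1)) * h1 - X (i+1) * (X (i+1) - X (i+1+1)) * h3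
  have N2 := congrArg (s (i+1)) N
  simp only [map_mul, map_sub, s_X_left, s_X_right, x1, s_s, ← hb] at N2
  apply mul_left_cancel₀ (mul_ne_zero (mul_ne_zero (X_ne (i := i) (j := i+1) (by omega))
    (X_ne (i := i) (j := i+1+1) (by omega))) (X_ne (i := i+1) (j := i+1+1) (by omega)))
  linear_combination -N2 - N

/-- Key families with variables indexed by the naturals below `n`. -/
structure Fam (n : ℕ) (KK : (ℕ → ℕ) → R) : Prop where
  dom : ∀ β : ℕ → ℕ, (∀ i, i + 1 < n → β (i+1) ≤ β i) → KK β = ∏ i ∈ range n, X i ^ β i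
  step : ∀ (β : ℕ → ℕ) (i : ℕ), i + 1 < n → β (i+1) < β i →
    IsXi i (KK β) (KK (β ∘ Equiv.swap i (i+1)))

lemma s_monomial (n i : ℕ) (hi : i + 1 < n) (β : ℕ → ℕ) (h : β i = β (i+1)) :
    s i (∏ j ∈ range n, X j ^ β j) = ∏ j ∈ range n, X j ^ β j := by
  rw [map_prod]
  apply prod_equiv (Equiv.swap i (i+1))
  · intro j
    simp only [mem_range, Equiv.swap_apply_def]
    grind
  · intro j _
    rw [map_pow, s_X]
    congr 1
    simp only [Equiv.swap_apply_def]
    grind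

lemma s_prod_other (i : ℕ) (S : Finset ℕ) (τ : ℕ → ℕ) (h1 : i ∉ S) (h2 : i + 1 ∉ S) :
    s i (∏ j ∈ S, X j ^ τ j) = ∏ j ∈ S, X j ^ τ j := by
  rw [map_prod]
  apply prod_congr rfl
  intro j hj
  rw [map_pow, s_X_other]
  · rintro rfl; exact h1 hj
  · rintro rfl; exact h2 hj

/-- the termination measure -/
def wt (n : ℕ) (β : ℕ → ℕ) : ℕ := ∑ j ∈ range n, j * β j

lemma wt_lt (n i : ℕ) (hi : i + 1 < n) (β : ℕ → ℕ) (h : β i < β (i+1)) :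
    wt n (β ∘ Equiv.swap i (i+1)) < wt n β := by
  have e : ∀ γ : ℕ → ℕ, wt n γ = ∑ j ∈ (range n).erase i |>.erase (i+1), j * γ j
      + (i+1) * γ (i+1) + i * γ i := by
    intro γ
    unfold wt
    rw [sum_erase_add _ _ (by simp; omega), sum_erase_add _ _ (by simp; omega)]
  rw [e, e β]
  have : ∑ j ∈ (range n).erase i |>.erase (i+1), j * (β ∘ Equiv.swap i (i+1)) j
      = ∑ j ∈ (range n).erase i |>.erase (i+1), j * β j := by
    apply sum_congr rfl
    intro j hj
    simp only [mem_erase] at hj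
    rw [Function.comp, Equiv.swap_apply_of_ne_of_ne hj.2.1 hj.1]
  rw [this]
  simp only [Function.comp, Equiv.swap_apply_left, Equiv.swap_apply_right]
  nlinarith

lemma swap_swap_comp (i : ℕ) (β : ℕ → ℕ) :
    (β ∘ Equiv.swap i (i+1)) ∘ Equiv.swap i (i+1) = β := by
  funext x; simp

/-- every ascent can be undone -/
lemma Fam.up {n : ℕ} {KK : (ℕ → ℕ) → R} (F : Fam n KK) (β : ℕ → ℕ) (i : ℕ) (hi : i + 1 < n)
    (h : β i < β (i+1)) : IsXi i (KK (β ∘ Equiv.swap i (i+1))) (KK β) := by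
  have := F.step (β ∘ Equiv.swap i (i+1)) i hi (by simpa using h)
  rwa [swap_swap_comp] at this

lemma Fam.symm {n : ℕ} {KK : (ℕ → ℕ) → R} (F : Fam n KK) (β : ℕ → ℕ) (i : ℕ) (hi : i + 1 < n)
    (h : β i = β (i+1)) : s i (KK β) = KK β := by
  induction hw : wt n β using Nat.strong_induction_on generalizing β i with
  | _ w ih =>
  subst hw
  by_cases ha : ∀ j, j + 1 < n → β (j+1) ≤ β j
  · rw [F.dom β ha]; exact s_monomial n i hi β h
  push Not at ha
  obtain ⟨j, hj, hlt⟩ := ha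
  have hX := F.up β j hj hlt
  have hwt := wt_lt n j hj β hlt
  by_cases hfar : i + 2 ≤ j ∨ j + 2 ≤ i
  · refine hX.far hfar (ih _ hwt _ i hi ?_ rfl)
    simp only [Function.comp]
    rw [Equiv.swap_apply_of_ne_of_ne, Equiv.swap_apply_of_ne_of_ne] <;> grind
  have hne : j ≠ i := by rintro rfl; omega
  have hc : j = i + 1 ∨ i = j + 1 := by omega
  rcases hc with rfl | rfl
  · set γ := β ∘ Equiv.swap (i+1) (i+1+1) with hγ
    have hlt2 : γ i < γ (i+1) := by
      simp only [hγ, Function.comp, Equiv.swap_apply_def]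
      grind
    have hX2 := F.up γ i hi hlt2
    have hwt2 := wt_lt n i hi γ hlt2
    refine braid1 (ih _ (hwt2.trans hwt) _ (i+1) hj ?_ rfl) hX2 hX
    simp only [hγ, Function.comp, Equiv.swap_apply_def]
    grind
  · set γ := β ∘ Equiv.swap j (j+1) with hγ
    have hlt2 : γ (j+1) < γ (j+1+1) := by
      simp only [hγ, Function.comp, Equiv.swap_apply_def]
      grind
    have hX2 := F.up γ (j+1) hi hlt2
    have hwt2 := wt_lt n (j+1) hi γ hlt2
    refine braid2 (ih _ (hwt2.trans hwt) _ j hj ?_ rfl) hX2 hX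
    simp only [hγ, Function.comp, Equiv.swap_apply_def]
    grind

/-- Combinations of keys in the first `t` variables, with arbitrary monomials in the others. -/
noncomputable def Cone (n : ℕ) (KK : (ℕ → ℕ) → R) (t : ℕ) : AddSubmonoid R :=
  AddSubmonoid.closure {f | ∃ β τ : ℕ → ℕ, (∀ i, t ≤ i → β i = 0) ∧
    f = KK β * ∏ i ∈ Ico t n, X i ^ τ i}

lemma cone_mul {n : ℕ} {KK : (ℕ → ℕ) → R} {t : ℕ} (σ : ℕ → ℕ) {f : R}
    (hf : f ∈ Cone n KK t) : f * ∏ i ∈ Ico t n, X i ^ σ i ∈ Cone n KK t := by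
  induction hf using AddSubmonoid.closure_induction with
  | mem f hf =>
    obtain ⟨β, τ, hβ, rfl⟩ := hf
    apply AddSubmonoid.subset_closure
    refine ⟨β, fun i => τ i + σ i, hβ, ?_⟩
    rw [mul_assoc, ← prod_mul_distrib]
    simp only [pow_add]
  | zero => simp [zero_mem]
  | add f g _ _ hf hg => rw [add_mul]; exact add_mem hf hg

lemma cone_xi {n : ℕ} {KK : (ℕ → ℕ) → R} (F : Fam n KK) {t : ℕ} (ht : t ≤ n) {i : ℕ}
    (hi : i + 1 < t) {f : R} (hf : f ∈ Cone n KK t) : ∃ g ∈ Cone n KK t, IsXi i f g := by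
  induction hf using AddSubmonoid.closure_induction with
  | mem f hf =>
    obtain ⟨β, τ, hβ, rfl⟩ := hf
    have hs : s i (∏ i ∈ Ico t n, X i ^ τ i) = ∏ i ∈ Ico t n, X i ^ τ i :=
      s_prod_other _ _ _ (by simp; omega) (by simp; omega)
    rcases lt_trichotomy (β i) (β (i+1)) with h | h | h
    · refine ⟨_, AddSubmonoid.subset_closure ⟨β, τ, hβ, rfl⟩, IsXi.of_symm ?_⟩
      rw [map_mul, hs, (F.up β i (by omega) h).symm_right]
    · refine ⟨_, AddSubmonoid.subset_closure ⟨β, τ, hβ, rfl⟩, IsXi.of_symm ?_⟩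
      rw [map_mul, hs, F.symm β i (by omega) h]
    · refine ⟨_, AddSubmonoid.subset_closure ⟨β ∘ Equiv.swap i (i+1), τ, ?_, rfl⟩, ?_⟩
      · intro j hj
        rw [Function.comp, Equiv.swap_apply_of_ne_of_ne (by omega) (by omega)]
        exact hβ j hj
      · rw [mul_comm, mul_comm (KK (β ∘ _))]
        exact (F.step β i (by omega) h).mul hs
  | zero => exact ⟨0, zero_mem _, IsXi.zero i⟩
  | add f g _ _ hf hg =>
    obtain ⟨f', hf', h1⟩ := hf
    obtain ⟨g', hg', h2⟩ := hg
    exact ⟨f' + g', add_mem hf' hg', h1.add h2⟩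

lemma cone_dom {n : ℕ} {KK : (ℕ → ℕ) → R} (F : Fam n KK) {t : ℕ} (ht : t ≤ n) (l : ℕ → ℕ)
    (hl : ∀ i, l (i+1) ≤ l i) : ∏ i ∈ range n, X i ^ l i ∈ Cone n KK t := by
  apply AddSubmonoid.subset_closure
  refine ⟨fun i => if i < t then l i else 0, l, fun i hi => if_neg (by omega), ?_⟩
  rw [F.dom]
  · rw [← prod_range_mul_prod_Ico _ ht, ← prod_range_mul_prod_Ico _ ht]
    have e1 : ∏ k ∈ range t, (X k : R) ^ (if k < t then l k else 0)
        = ∏ k ∈ range t, X k ^ l k :=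
      prod_congr rfl fun k hk => by rw [if_pos (mem_range.1 hk)]
    have e2 : ∏ k ∈ Ico t n, (X k : R) ^ (if k < t then l k else 0) = 1 :=
      prod_eq_one fun k hk => by rw [mem_Ico] at hk; rw [if_neg (by omega), pow_zero]
    rw [e1, e2, mul_one]
  · intro i _
    have := hl i
    split_ifs <;> omega

/-- The coefficient polynomials. -/
noncomputable def Q (l : ℕ → ℕ) (k : ℕ) : ℕ → ℕ → R
  | 0, c => if c = l k then ∏ i ∈ range k, X i ^ l i else 0
  | j+1, b => ∑ c ∈ Icc (max b (l (k+j))) (l k), X (k+j) ^ (l (k+j+1) + c - b) * Q l k j c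

lemma Q_symm (l : ℕ → ℕ) (k j i c : ℕ) (h : k + j ≤ i) : s i (Q l k j c) = Q l k j c := by
  induction j generalizing c with
  | zero =>
    rw [Q]
    split_ifs
    · exact s_prod_other _ _ _ (by simp; omega) (by simp; omega)
    · simp
  | succ j ih =>
    rw [Q, map_sum]
    apply sum_congr rfl
    intro c _
    rw [map_mul, map_pow, ih _ (by omega), s_X_other _ _ (by omega) (by omega)]

/-- Move the entry at position `k` to position `k + j`. -/
def mv (l : ℕ → ℕ) (k j : ℕ) : ℕ → ℕ := fun i =>
  if i < k then l i else if i < k + j then l (i+1) else if i = k + j then l k else l i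

lemma mv_succ (l : ℕ → ℕ) (k j : ℕ) :
    mv l k (j+1) = mv l k j ∘ Equiv.swap (k+j) (k+j+1) := by
  funext i
  simp only [mv, Function.comp, Equiv.swap_apply_def]
  grind

lemma anti_of (l : ℕ → ℕ) (hl : ∀ i, l (i+1) ≤ l i) {i j : ℕ} (h : i ≤ j) : l j ≤ l i :=
  antitone_nat_of_succ_le hl h

/-- Claim A -/
lemma KK_mv {n : ℕ} {KK : (ℕ → ℕ) → R} (F : Fam n KK) (l : ℕ → ℕ) (hl : ∀ i, l (i+1) ≤ l i)
    (k j : ℕ) (hk : k + j < n) (hne : 0 < j → l (k+1) < l k) :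
    KK (mv l k j) = (∑ b ∈ Icc (l (k+j)) (l k), X (k+j) ^ b * Q l k j b)
      * ∏ i ∈ Ico (k+j+1) n, X i ^ l i := by
  induction j with
  | zero =>
    have : mv l k 0 = l := by
      funext i; simp only [mv]; grind
    rw [this, F.dom l (fun i _ => hl i)]
    simp only [add_zero, Icc_self, sum_singleton, Q, if_true]
    rw [← prod_range_mul_prod_Ico _ hk, add_zero, prod_range_succ]
    ring
  | succ j ih =>
    have hlt := hne (by omega)
    have ih := ih (by omega) (fun _ => hlt)
    have h1 := F.step (mv l k j) (k+j) (by omega) (by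
      have := anti_of l hl (show k + 1 ≤ k + j + 1 by omega)
      simp only [mv]; grind)
    rw [← mv_succ] at h1
    refine h1.unique ?_
    have hc := core (k+j) (l (k+j+1)) (l (k+j+1)) (l (k+j)) (l k) (Q l k j)
      (fun c => Q_symm _ _ _ _ _ le_rfl)
    have hT : s (k+j) (∏ i ∈ Ico (k+j+1+1) n, X i ^ l i) = ∏ i ∈ Ico (k+j+1+1) n, X i ^ l i :=
      s_prod_other _ _ _ (by simp) (by simp)
    have := hc.mul hT
    convert this using 1
    · rw [ih, prod_eq_prod_Ico_succ_bot (by omega), max_eq_right (hl _)]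
      simp only [Nat.add_sub_cancel_left]
      ring
    · rw [mul_comm]
      simp only [Nat.add_sub_cancel_left]
      rfl

/-- Claim B -/
lemma Q_mem {n t : ℕ} (C : AddSubmonoid R) (ht : t ≤ n)
    (hC1 : ∀ l : ℕ → ℕ, (∀ i, l (i+1) ≤ l i) → ∏ i ∈ range n, X i ^ l i ∈ C)
    (hC2 : ∀ i f, i + 1 < t → f ∈ C → ∃ g ∈ C, IsXi i f g)
    (l : ℕ → ℕ) (hl : ∀ i, l (i+1) ≤ l i) (k j b : ℕ) (hj : k + j ≤ t)
    (hb : l (k+j) ≤ b) (hba : b ≤ l k) (τ : ℕ → ℕ) (hτ : ∀ i, k + j ≤ i → τ (i+1) ≤ τ i)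
    (hτ0 : τ (k+j) ≤ l (k+j)) :
    Q l k j b * ∏ i ∈ Ico (k+j) n, X i ^ τ i ∈ C := by
  induction j generalizing b τ with
  | zero =>
    have : b = l k := le_antisymm hba hb
    subst this
    have := hC1 (fun i => if i < k then l i else τ i) (by
      intro i
      have h1 := hl i
      have h2 := hτ i
      simp only [add_zero] at hτ0 h2
      split_ifs with h3 h4 h4
      · exact h1
      · omega
      · have : i + 1 = k := by omega
        subst this; omega
      · exact h2 (by omega))
    rw [← prod_range_mul_prod_Ico _ (show k ≤ n by omega)] at this
    rw [Q, if_pos rfl, add_zero]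
    convert this using 2
    · exact prod_congr rfl fun i hi => by rw [if_pos (mem_range.1 hi)]
    · exact prod_congr rfl fun i hi => by rw [mem_Ico] at hi; rw [if_neg (by omega)]
  | succ j ih =>
    have hpq := hl (k+j)
    -- terms with a small exponent
    have small : ∀ c x, l (k+j) ≤ c → c ≤ l k → l (k+j+1) ≤ x → x ≤ l (k+j) →
        X (k+j) ^ x * Q l k j c * ∏ i ∈ Ico (k+(j+1)) n, X i ^ τ i ∈ C := by
      intro c x h1 h2 h3 h4
      have := ih c (by omega) h1 h2 (fun i => if i = k + j then x else τ i) (by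
        intro i hi
        have h5 := hτ i
        rw [if_neg (by omega)]
        split_ifs with h6
        · subst h6; exact hτ0.trans h3
        · exact h5 (by omega)) (by simpa using h4)
      rw [prod_eq_prod_Ico_succ_bot (by omega), if_pos rfl] at this
      have e : ∏ i ∈ Ico (k+j+1) n, (X i : R) ^ (if i = k + j then x else τ i)
          = ∏ i ∈ Ico (k+(j+1)) n, X i ^ τ i :=
        prod_congr rfl fun i hi => by rw [mem_Ico] at hi; rw [if_neg (by omega)]
      rw [e] at this
      convert this using 1
      ring
    rw [← add_assoc] at hb
    rw [Q]
    rcases j with _ | i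
    · rw [sum_mul]
      apply sum_mem
      intro c hc
      rw [mem_Icc] at hc
      simp only [add_zero] at hc hb hpq small ⊢
      exact small c _ (by omega) (by omega) (by omega) (by omega)
    · set p := l (k+(i+1)) with hp
      set q := l (k+(i+1)+1) with hq
      set a := l k with ha
      have hsplit : ∑ c ∈ Icc (max b p) a, X (k+(i+1)) ^ (q + c - b) * Q l k (i+1) c
          = ∑ c ∈ Icc (max b p) a with c < b + p - q,
              X (k+(i+1)) ^ (q + c - b) * Q l k (i+1) c
            + ∑ c ∈ Icc (b + p - q) a,
              X (k+(i+1)) ^ (p + c - (b + p - q)) * Q l k (i+1) c := by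
        rw [← sum_filter_add_sum_filter_not (Icc (max b p) a) (fun c => c < b + p - q)]
        congr 1
        apply sum_congr
        · ext c; simp only [mem_filter, mem_Icc]; omega
        · intro c hc
          rw [mem_Icc] at hc
          rw [show q + c - b = p + c - (b + p - q) by omega]
      rw [hsplit, add_mul]
      apply add_mem
      · rw [sum_mul]
        apply sum_mem
        intro c hc
        rw [mem_filter, mem_Icc] at hc
        exact small c _ (by omega) (by omega) (by omega) (by omega)
      · by_cases hb' : b + p - q ≤ a
        · have m1 := small (b + p - q) p (by omega) hb' hpq le_rfl
          obtain ⟨g, hg, hX⟩ := hC2 (k+i) _ (by omega) m1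
          have hc := core (k+i) p (b + p - q) (l (k+i)) a (Q l k i)
            (fun c => Q_symm _ _ _ _ _ le_rfl)
          have hT : s (k+i) (∏ x ∈ Ico (k+(i+1+1)) n, X x ^ τ x)
              = ∏ x ∈ Ico (k+(i+1+1)) n, X x ^ τ x :=
            s_prod_other _ _ _ (by rw [mem_Ico]; omega) (by rw [mem_Ico]; omega)
          have h2 := hc.mul hT
          rw [mul_comm] at h2
          have := hX.unique h2
          rw [this, mul_comm] at hg
          exact hg
        · rw [Icc_eq_empty (by omega)]
          simp [zero_mem]

lemma cone_step {n : ℕ} {KK : (ℕ → ℕ) → R} (F : Fam n KK) {t : ℕ} (ht : t < n) (β : ℕ → ℕ)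
    (hβ : ∀ i, t + 1 ≤ i → β i = 0) : KK β ∈ Cone n KK t := by
  induction hw : wt n β using Nat.strong_induction_on generalizing β with
  | _ w ih =>
  subst hw
  by_cases hasc : ∃ i, i + 1 < t ∧ β i < β (i+1)
  · obtain ⟨i, hi, hlt⟩ := hasc
    have h1 := F.up β i (by omega) hlt
    obtain ⟨g, hg, h2⟩ := cone_xi F ht.le hi
      (ih _ (wt_lt n i (by omega) β hlt) (β ∘ Equiv.swap i (i+1)) (by
        intro j hj
        rw [Function.comp, Equiv.swap_apply_of_ne_of_ne (by omega) (by omega)]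
        exact hβ j hj) rfl)
    rw [h1.unique h2]; exact hg
  push Not at hasc
  have hex : ∃ k, k = t ∨ (k < t ∧ β k < β t) := ⟨t, Or.inl rfl⟩
  classical
  obtain ⟨k, hk, hmin⟩ : ∃ k, (k = t ∨ (k < t ∧ β k < β t)) ∧
      ∀ m < k, ¬ (m = t ∨ (m < t ∧ β m < β t)) :=
    ⟨Nat.find hex, Nat.find_spec hex, fun m hm => Nat.find_min hex hm⟩
  have hkt : k ≤ t := by omega
  obtain ⟨j, rfl⟩ := Nat.exists_eq_add_of_le hkt
  let l : ℕ → ℕ := fun i => if i < k then β i else if i = k then β (k+j)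
    else if i ≤ k + j then β (i-1) else 0
  have hl : ∀ i, l (i+1) ≤ l i := by
    intro i
    have h1 := hasc i
    have h2 := hasc (i-1)
    have h3 := hmin i
    simp only [l]
    grind
  have hmv : mv l k j = β := by
    funext i
    have := hβ i
    simp only [mv, l]
    grind
  have hA := KK_mv F l hl k j ht (by
    intro hj
    simp only [l]
    grind)
  rw [hmv] at hA
  rw [hA, sum_mul]
  apply sum_mem
  intro b hb
  rw [mem_Icc] at hb
  have hB := Q_mem (Cone n KK (k+j)) ht.le (fun l hl => cone_dom F ht.le l hl)
    (fun i f hi hf => cone_xi F ht.le hi hf) l hl k j b le_rfl hb.1 hb.2 (fun _ => 0)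
    (fun _ _ => le_rfl) (Nat.zero_le _)
  simp only [pow_zero, prod_const_one, mul_one] at hB
  have := cone_mul (fun i => if i = k + j then b else l i) hB
  rw [prod_eq_prod_Ico_succ_bot ht, if_pos rfl] at this
  have e : ∏ i ∈ Ico (k+j+1) n, (X i : R) ^ (if i = k + j then b else l i)
      = ∏ i ∈ Ico (k+j+1) n, X i ^ l i :=
    prod_congr rfl fun i hi => by rw [mem_Ico] at hi; rw [if_neg (by omega)]
  rw [e] at this
  convert this using 1
  ring

lemma cone_le {n : ℕ} {KK : (ℕ → ℕ) → R} (F : Fam n KK) {t : ℕ} (ht : t < n) :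
    Cone n KK (t+1) ≤ Cone n KK t := by
  refine (AddSubmonoid.closure_le).2 ?_
  rintro f ⟨β, τ, hβ, rfl⟩
  have := cone_mul (fun i => if i = t then 0 else τ i) (cone_step F ht β hβ)
  rw [prod_eq_prod_Ico_succ_bot ht, if_pos rfl, pow_zero, one_mul] at this
  have e : ∏ i ∈ Ico (t+1) n, (X i : R) ^ (if i = t then 0 else τ i)
      = ∏ i ∈ Ico (t+1) n, X i ^ τ i :=
    prod_congr rfl fun i hi => by rw [mem_Ico] at hi; rw [if_neg (by omega)]
  rw [e] at this
  exact this

lemma cone_zero {n : ℕ} {KK : (ℕ → ℕ) → R} (F : Fam n KK) {t : ℕ} (ht : t ≤ n) :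
    Cone n KK t ≤ Cone n KK 0 := by
  induction t with
  | zero => exact le_rfl
  | succ t ih => exact (cone_le F ht).trans (ih (by omega))

lemma coeff_cone_zero {n : ℕ} {KK : (ℕ → ℕ) → R} (F : Fam n KK) {f : R}
    (hf : f ∈ Cone n KK 0) (m : ℕ →₀ ℕ) : ∃ c : ℕ, coeff m f = (c : ℚ) := by
  induction hf using AddSubmonoid.closure_induction with
  | mem f hf =>
    obtain ⟨β, τ, hβ, rfl⟩ := hf
    have h0 : KK β = 1 := by
      rw [F.dom β (fun i _ => by rw [hβ _ (Nat.zero_le _)]; exact Nat.zero_le _)]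
      exact prod_eq_one fun i _ => by rw [hβ _ (Nat.zero_le _), pow_zero]
    have e : ∏ i ∈ Ico 0 n, (X i : R) ^ τ i
        = monomial (∑ i ∈ Ico 0 n, Finsupp.single i (τ i)) 1 := by
      rw [monomial_sum_one]
      exact prod_congr rfl fun i _ => X_pow_eq_monomial
    rw [h0, one_mul, e, coeff_monomial]
    split_ifs
    · exact ⟨1, by simp⟩
    · exact ⟨0, by simp⟩
  | zero => exact ⟨0, by simp⟩
  | add f g _ _ hf hg =>
    obtain ⟨c, hc⟩ := hf
    obtain ⟨d, hd⟩ := hg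
    exact ⟨c + d, by rw [coeff_add, hc, hd]; push_cast; rfl⟩

lemma val_comp_swap {n : ℕ} (a b : Fin n) (hab : (b : ℕ) = (a : ℕ) + 1) :
    (Fin.val ∘ Equiv.swap a b) = (Equiv.swap (a : ℕ) ((a : ℕ)+1)) ∘ Fin.val := by
  funext x
  simp only [Function.comp, Equiv.swap_apply_def, ← hab, Fin.ext_iff]
  split_ifs <;> rfl

lemma fam_of {n : ℕ} {K : (Fin n → ℕ) → MvPolynomial (Fin n) ℚ} (hK : IsKeyFamily n K) :
    Fam n (fun β => rename Fin.val (K (β ∘ Fin.val))) := by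
  obtain ⟨h1, h2⟩ := hK
  constructor
  · intro β hβ
    have hanti : Antitone (β ∘ (Fin.val : Fin n → ℕ)) := by
      have : ∀ d i, i + d < n → β (i + d) ≤ β i := by
        intro d
        induction d with
        | zero => intro i _; exact le_rfl
        | succ d ih =>
          intro i hi
          exact (hβ (i+d) hi).trans (ih i (by omega))
      intro x y hxy
      obtain ⟨d, hd⟩ := Nat.exists_eq_add_of_le (Fin.le_def.1 hxy)
      have := this d x (by rw [← hd]; exact y.2)
      rw [← hd] at this
      exact this
    rw [h1 _ hanti, map_prod, prod_range]
    simp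
  · intro β i hi hlt
    have := congrArg (rename (R := ℚ) (Fin.val : Fin n → ℕ)) (h2 (β ∘ Fin.val) ⟨i, by omega⟩ ⟨i+1, hi⟩ rfl hlt)
    simp only [map_mul, map_sub, rename_X, rename_rename] at this
    rw [val_comp_swap _ _ rfl, ← rename_rename, Function.comp_assoc, val_comp_swap _ _ rfl] at this
    exact this

end KeyPos

open MvPolynomial

/-- Every key polynomial has nonnegative integer coefficients in its monomial
expansion. -/
theorem key_monomial_positivity (n : ℕ)
    (K : (Fin n → ℕ) → MvPolynomial (Fin n) ℚ) (hK : IsKeyFamily n K)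
    (α : Fin n → ℕ) (m : Fin n →₀ ℕ) :
    ∃ c : ℕ, coeff m (K α) = (c : ℚ) := by
  have F := KeyPos.fam_of hK
  let β : ℕ → ℕ := fun i => if h : i < n then α ⟨i, h⟩ else 0
  have hβ : β ∘ Fin.val = α := by
    funext i; simp [β]
  have hmem : rename Fin.val (K (β ∘ Fin.val)) ∈
      KeyPos.Cone n (fun β => rename Fin.val (K (β ∘ Fin.val))) n := by
    apply AddSubmonoid.subset_closure
    refine ⟨β, 0, fun i hi => dif_neg (by omega), ?_⟩
    simp
  obtain ⟨c, hc⟩ := KeyPos.coeff_cone_zero F (KeyPos.cone_zero F le_rfl hmem)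
    (m.mapDomain Fin.val)
  rw [hβ, coeff_rename_mapDomain _ Fin.val_injective] at hc
  exact ⟨c, hc⟩
end
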